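/- Let n ≥ 1, let Ω₁, Ω₂ be real symmetric 2n×2n matrices and Ω₁₂ a real 2n×2n matrix. Define R = [[Ω₁, Ω₁₂],[Ω₁₂ᵀ, Ω₂]] and A_H = 2·J_{2n}·R. If Π^⊥·A_H·Π = 0, then Ω₁ + Ω₁₂ = Ω₁₂ᵀ + Ω₂, and moreover Ω₁ = Ω₂ and Ω₁₂ = Ω₁₂ᵀ. -/

import Mathlib

open Matrix

/-- `J_k = I_k ⊗ J` where `J = [[0,1],[-1,0]]`: the `2k × 2k` block-diagonal matrix
with `2×2` blocks `J` (interleaved coordinate ordering). -/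
def Jmat (k : ℕ) : Matrix (Fin (2*k)) (Fin (2*k)) ℝ :=
  Matrix.of fun i j =>
    if (i : ℕ) % 2 = 0 ∧ (j : ℕ) = (i : ℕ) + 1 then 1
    else if (i : ℕ) % 2 = 1 ∧ (j : ℕ) + 1 = (i : ℕ) then -1 else 0

/-- `J_{2n}` on the doubled (augmented) space, identified with
`fromBlocks (Jmat n) 0 0 (Jmat n)`. -/
def J2n (n : ℕ) : Matrix (Fin (2*n) ⊕ Fin (2*n)) (Fin (2*n) ⊕ Fin (2*n)) ℝ :=
  Matrix.fromBlocks (Jmat n) 0 0 (Jmat n)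

/-- The orthogonal projection `Π = (1/2)[[I,I],[I,I]]`. -/
noncomputable def PiProj (n : ℕ) :
    Matrix (Fin (2*n) ⊕ Fin (2*n)) (Fin (2*n) ⊕ Fin (2*n)) ℝ :=
  (1/2 : ℝ) • Matrix.fromBlocks 1 1 1 1

/-- The complementary projection `Π^⊥ = (1/2)[[I,-I],[-I,I]]`. -/
noncomputable def PiPerp (n : ℕ) :
    Matrix (Fin (2*n) ⊕ Fin (2*n)) (Fin (2*n) ⊕ Fin (2*n)) ℝ :=
  (1/2 : ℝ) • Matrix.fromBlocks 1 (-1) (-1) 1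

/-- The row of `J_k` indexed by the partner of `i` is supported at `i`, so `J_k` is left cancellable. -/
theorem Jmat_mul_eq_zero {k : ℕ} {m : Type*} {X : Matrix (Fin (2*k)) m ℝ}
    (h : Jmat k * X = 0) : X = 0 := by
  ext i j
  rcases Nat.mod_two_eq_zero_or_one (i : ℕ) with hi | hi
  · have hlt : (i : ℕ) + 1 < 2 * k := by have := i.isLt; omega
    have hij := congrFun (congrFun h ⟨(i : ℕ) + 1, hlt⟩) j
    rw [Matrix.mul_apply, Finset.sum_eq_single i] at hij
    · have hodd : ((i : ℕ) + 1) % 2 = 1 := by omega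
      simpa [Jmat, hodd] using hij
    · intro b _ hb
      have hb' : (b : ℕ) ≠ i := fun e => hb (Fin.ext e)
      have heven : ¬ ((i : ℕ) + 1) % 2 = 0 := by omega
      simp [Jmat, heven, hb']
    · simp
  · have hlt : (i : ℕ) - 1 < 2 * k := by have := i.isLt; omega
    have hij := congrFun (congrFun h ⟨(i : ℕ) - 1, hlt⟩) j
    have heven : ((i : ℕ) - 1) % 2 = 0 := by omega
    have hsucc : (i : ℕ) - 1 + 1 = i := by omega
    rw [Matrix.mul_apply, Finset.sum_eq_single i] at hij
    · simpa [Jmat, heven, hsucc] using hij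
    · intro b _ hb
      have hb' : (b : ℕ) ≠ i := fun e => hb (Fin.ext e)
      simp [Jmat, heven, hsucc, hb']
    · simp

theorem stmt_13 {n : ℕ} (hn : 1 ≤ n)
    (Ω₁ Ω₂ Ω₁₂ : Matrix (Fin (2*n)) (Fin (2*n)) ℝ)
    (hΩ₁sym : Ω₁ᵀ = Ω₁) (hΩ₂sym : Ω₂ᵀ = Ω₂)
    (R : Matrix (Fin (2*n) ⊕ Fin (2*n)) (Fin (2*n) ⊕ Fin (2*n)) ℝ)
    (hR : R = Matrix.fromBlocks Ω₁ Ω₁₂ Ω₁₂ᵀ Ω₂)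
    (AH : Matrix (Fin (2*n) ⊕ Fin (2*n)) (Fin (2*n) ⊕ Fin (2*n)) ℝ)
    (hAH : AH = (2 : ℝ) • (J2n n * R))
    (hzero : PiPerp n * AH * PiProj n = 0) :
    Ω₁ + Ω₁₂ = Ω₁₂ᵀ + Ω₂ ∧ Ω₁ = Ω₂ ∧ Ω₁₂ = Ω₁₂ᵀ := by
  have hsum : Ω₁ + Ω₁₂ = Ω₁₂ᵀ + Ω₂ := by
    rw [← sub_eq_zero]
    apply Jmat_mul_eq_zero
    subst hAH hR
    have hblock := congrArg Matrix.toBlocks₁₁ hzero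
    simp only [PiPerp, PiProj, J2n, Matrix.smul_mul, Matrix.mul_smul, smul_smul,
      Matrix.fromBlocks_multiply, Matrix.fromBlocks_smul, Matrix.toBlocks_fromBlocks₁₁] at hblock
    have hscaled : (1 / 2 : ℝ) • (Jmat n * (Ω₁ + Ω₁₂ - (Ω₁₂ᵀ + Ω₂))) = 0 := by
      refine Eq.trans ?_ hblock
      simp only [Matrix.mul_sub, Matrix.mul_add, Matrix.one_mul, Matrix.mul_one, Matrix.neg_mul,
        Matrix.zero_mul, zero_add, add_zero]
      module
    exact (smul_eq_zero.mp hscaled).resolve_left (by norm_num)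
  have hsumT : Ω₁ + Ω₁₂ᵀ = Ω₁₂ + Ω₂ := by
    simpa [hΩ₁sym, hΩ₂sym] using congrArg Matrix.transpose hsum
  have hdiag : Ω₁ = Ω₂ := by
    ext i j
    have h₁ := congrFun (congrFun hsum i) j
    have h₂ := congrFun (congrFun hsumT i) j
    simp only [Matrix.add_apply] at h₁ h₂
    linarith
  refine ⟨hsum, hdiag, ?_⟩
  rw [hdiag, add_comm] at hsum
  exact add_right_cancel hsum
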